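/- Let k ≥ 2 be a fixed integer and, for each positive integer m, let r(k,m) denote the infimum of the set of real numbers r > 0 for which there exists a DD(m,r) with maximal k-hop coverage. Then, as m → ∞, the lower asymptotic bound liminf_{m→∞} r(k,m)/m^k ≥ 1/(√π · k! · k) holds, and the upper asymptotic bound limsup_{m→∞} r(k,m)/m^k ≤ (1/2)·(16/π)^k holds; i.e. m^k/(√π·k!·k) + o(m^k) ≤ r(k,m) ≤ (1/2)(16/π)^k m^k + o(m^k). -/

import Mathlib

/-- All differences of distinct pairs of points of `D` are pairwise distinct. -/
def HasDistinctDifferences {G : Type*} [AddCommGroup G] (D : Set G) : Prop :=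
  ∀ v ∈ D, ∀ w ∈ D, ∀ v' ∈ D, ∀ w' ∈ D,
    v ≠ w → v' ≠ w' → v - w = v' - w' → v = v' ∧ w = w'

/-- The set of nonzero elements expressible as a sum of at most `k` difference
vectors of `D`. -/
def khopSet {G : Type*} [AddCommGroup G] (D : Set G) (k : ℕ) : Set G :=
  {x | x ≠ 0 ∧ ∃ ℓ : ℕ, ℓ ≤ k ∧ ∃ a b : Fin ℓ → G,
    (∀ i, a i ∈ D ∧ b i ∈ D ∧ a i ≠ b i) ∧ x = ∑ i, (a i - b i)}

/-- `Ck D k` is the `k`-hop coverage of `D`. -/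
noncomputable def Ck {G : Type*} [AddCommGroup G] (D : Set G) (k : ℕ) : ℕ :=
  (khopSet D k).ncard

/-- `H m k` is the set of m-tuples of integers summing to 0 whose positive
entries sum to `k`. -/
def H (m k : ℕ) : Set (Fin m → ℤ) :=
  {a | ∑ i, a i = 0 ∧ ∑ i ∈ Finset.univ.filter (fun i => 0 < a i), a i = (k : ℤ)}

/-- The Euclidean distance between two points of ℤ². -/
noncomputable def euclDistZ (p q : ℤ × ℤ) : ℝ :=
  Real.sqrt (((p.1 - q.1 : ℤ) : ℝ) ^ 2 + ((p.2 - q.2 : ℤ) : ℝ) ^ 2)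

/-- `rkm k m` is the infimum of those `r > 0` for which there exists a
`DD(m,r)` with maximal `k`-hop coverage. -/
noncomputable def rkm (k m : ℕ) : ℝ :=
  sInf {r : ℝ | 0 < r ∧ ∃ D : Finset (ℤ × ℤ), D.card = m ∧
    HasDistinctDifferences (↑D : Set (ℤ × ℤ)) ∧
    (∀ v ∈ D, ∀ w ∈ D, euclDistZ v w ≤ r) ∧
    Ck (↑D : Set (ℤ × ℤ)) k = ∑ i ∈ Finset.Icc 1 k, (H m i).ncard}

open Polynomial in
/-- Equal products of linear factors have equal exponents. -/
lemma exponents_eq_of_prod_X_sub_C_pow_eq {ι F : Type*} [Fintype ι] [Field F] {e : ι → F}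
    (he : Function.Injective e) {n n' : ι → ℕ}
    (h : ∏ i, (X - C (e i)) ^ n i = ∏ i, (X - C (e i)) ^ n' i) : n = n' := by
  classical
  have key : ∀ n : ι → ℕ, ∀ j, (∏ i, (X - C (e i)) ^ n i).roots.count (e j) = n j := by
    intro n j
    rw [roots_prod _ _ (Finset.prod_ne_zero_iff.2 fun i _ => pow_ne_zero _ (X_sub_C_ne_zero _))]
    simp [Multiset.count_bind, Multiset.count_singleton, roots_pow, he.eq_iff,
      Multiset.count_nsmul]
  funext j
  rw [← key n j, h, key n' j]

/-- A family in an abelian group satisfying no nontrivial balanced integer relation whose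
positive coefficients sum to at most `h`. -/
def IsBhFamily {ι G : Type*} [Fintype ι] [AddCommGroup G] (h : ℕ) (f : ι → G) : Prop :=
  ∀ c : ι → ℤ, ∑ i, c i = 0 → ∑ i, max (c i) 0 ≤ h → ∑ i, c i • f i = 0 → c = 0

open Polynomial in
/-- Linear factors `θ - e i` at an element `θ` of degree `h` are multiplicatively independent for
balanced relations of weight at most `h`. -/
lemma isBhFamily_ofMul_of_algebraMap_sub {ι F K : Type*} [Fintype ι] [Field F] [Field K]
    [Algebra F K] {e : ι → F} (he : Function.Injective e) {θ : K} {h : ℕ}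
    (hθ : (minpoly F θ).natDegree = h) {u : ι → Kˣ}
    (hu : ∀ i, (u i : K) = θ - algebraMap F K (e i)) :
    IsBhFamily h (fun i => Additive.ofMul (u i)) := by
  intro c hc hpos hrel
  have hsplit : ∀ i, c i = ((c i).toNat : ℤ) - ((-c i).toNat : ℤ) := fun i => by omega
  have hsum : ∑ i, (c i).toNat = ∑ i, (-c i).toNat := by
    have : ∑ i, (((c i).toNat : ℤ) - ((-c i).toNat : ℤ)) = 0 := by
      rw [← hc]; exact Finset.sum_congr rfl fun i _ => (hsplit i).symm
    rw [Finset.sum_sub_distrib, sub_eq_zero] at this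
    exact_mod_cast this
  have hle : ∑ i, (c i).toNat ≤ h := by
    zify
    simpa [Int.ofNat_toNat] using hpos
  have hu1 : ∏ i, u i ^ (c i).toNat = ∏ i, u i ^ (-c i).toNat := by
    have h1 : ∏ i, u i ^ c i = 1 := by
      have := congrArg Additive.toMul hrel
      simpa [toMul_sum] using this
    have h2 : ∏ i, u i ^ c i = (∏ i, u i ^ (c i).toNat) / ∏ i, u i ^ (-c i).toNat := by
      rw [← Finset.prod_div_distrib]
      refine Finset.prod_congr rfl fun i _ => ?_
      conv_lhs => rw [hsplit i, zpow_sub, zpow_natCast, zpow_natCast]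
      rw [div_eq_mul_inv]
    rw [h2, div_eq_one] at h1
    exact h1
  set P : (ι → ℕ) → F[X] := fun n => ∏ i, (X - C (e i)) ^ n i with hP
  have hmonic : ∀ n, (P n).Monic := fun n =>
    monic_prod_of_monic _ _ fun i _ => (monic_X_sub_C _).pow _
  have hdeg : ∀ n, (P n).natDegree = ∑ i, n i := by
    intro n
    rw [hP, natDegree_prod_of_monic _ _ fun i _ => (monic_X_sub_C _).pow _]
    simp [natDegree_pow]
  have heval : ∀ n, aeval θ (P n) = ((∏ i, u i ^ n i : Kˣ) : K) := by
    intro n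
    simp [hP, map_prod, hu]
  have hPeq : P (fun i => (c i).toNat) = P (fun i => (-c i).toNat) := by
    by_contra hne
    have hne' := sub_ne_zero.2 hne
    have hroot : aeval θ (P (fun i => (c i).toNat) - P (fun i => (-c i).toNat)) = 0 := by
      rw [map_sub, heval, heval, hu1, sub_self]
    have hint : IsIntegral F θ := 
      isAlgebraic_iff_isIntegral.1 ⟨_, hne', hroot⟩
    have h1 := minpoly.degree_le_of_ne_zero F θ hne' hroot
    have h2 : (P (fun i => (c i).toNat) - P (fun i => (-c i).toNat)).degree
        < (P (fun i => (c i).toNat)).degree := by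
      refine degree_sub_lt_left ?_ (hmonic _).ne_zero ?_
      · rw [degree_eq_natDegree (hmonic _).ne_zero, degree_eq_natDegree (hmonic _).ne_zero,
          hdeg, hdeg, hsum]
      · rw [(hmonic _).leadingCoeff, (hmonic _).leadingCoeff]
    have h3 := h1.trans_lt h2
    have h4 := natDegree_lt_natDegree (minpoly.ne_zero hint) h3
    rw [hdeg, hθ] at h4
    omega
  have := exponents_eq_of_prod_X_sub_C_pow_eq he hPeq
  funext i
  have := congrFun this i
  simp only [Pi.zero_apply] at this ⊢
  omega

/-- **Bose–Chowla**: any family of at most `p` indices admits exponents below `p ^ h` with the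
`B_h` property. -/
lemma exists_isBhFamily_natCast {ι : Type*} [Fintype ι] {p h : ℕ} [Fact p.Prime] (hh : 2 ≤ h)
    (hι : Fintype.card ι ≤ p) :
    ∃ x : ι → ℕ, (∀ i, x i < p ^ h) ∧ IsBhFamily h (fun i => (x i : ℤ)) := by
  have h0 : h ≠ 0 := by omega
  let K := GaloisField p h
  have : Fintype K := Fintype.ofFinite K
  obtain ⟨⟨e, he⟩⟩ : Nonempty (ι ↪ ZMod p) :=
    Function.Embedding.nonempty_of_card_le (by rwa [ZMod.card])
  obtain ⟨θ, hθ⟩ := Field.exists_primitive_element (ZMod p) K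
  have hdeg : (minpoly (ZMod p) θ).natDegree = h := by
    exact ((Field.primitive_element_iff_minpoly_natDegree_eq (ZMod p) θ).1 hθ).trans
      (GaloisField.finrank p h0)
  have hne : ∀ a : ZMod p, θ - algebraMap (ZMod p) K a ≠ 0 := by
    intro a ha
    rw [sub_eq_zero.1 ha, minpoly.eq_X_sub_C, Polynomial.natDegree_X_sub_C] at hdeg
    omega
  obtain ⟨g, hg⟩ := IsCyclic.exists_generator (α := Kˣ)
  have hlog : ∀ i, ∃ n < p ^ h, g ^ n = Units.mk0 _ (hne (e i)) := by
    intro i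
    obtain ⟨n, hn⟩ := mem_powers_iff_mem_zpowers.2 (hg (Units.mk0 _ (hne (e i))))
    refine ⟨n % orderOf g, (Nat.mod_lt _ (orderOf_pos g)).trans_le ?_,
      (pow_mod_orderOf g n).trans hn⟩
    rw [← GaloisField.card p h h0]
    exact (orderOf_le_card (x := g)).trans
      (Nat.card_le_card_of_injective _ Units.val_injective)
  choose x hx hgx using hlog
  refine ⟨x, hx, fun c hc hpos hrel => ?_⟩
  refine isBhFamily_ofMul_of_algebraMap_sub he hdeg (fun i => Units.val_mk0 (hne (e i))) c hc
    hpos ?_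
  have hsum : ∑ i, c i • (x i : ℤ) • Additive.ofMul g = 0 := by
    simpa only [map_sum, map_zero, map_zsmul, zmultiplesHom_apply] using
      congrArg (zmultiplesHom (Additive Kˣ) (Additive.ofMul g)) hrel
  rw [← hsum]
  refine Finset.sum_congr rfl fun i _ => ?_
  simp only [← hgx i, natCast_zsmul, ofMul_pow]

/-- Writing the terms of a family of naturals below `N ^ 2` in base `N` gives a planar `B_h` family
in an `N × N` box. -/
lemma IsBhFamily.prod_mod_div {ι : Type*} [Fintype ι] {h N : ℕ} {x : ι → ℕ}
    (hx : IsBhFamily h fun i => (x i : ℤ)) :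
    IsBhFamily h fun i => (((x i % N : ℕ) : ℤ), ((x i / N : ℕ) : ℤ)) := by
  intro c hc hpos hrel
  refine hx c hc hpos ?_
  have h1 := congrArg Prod.fst hrel
  have h2 := congrArg Prod.snd hrel
  simp only [Prod.fst_sum, Prod.snd_sum, Prod.smul_fst, Prod.smul_snd, Prod.fst_zero,
    Prod.snd_zero, smul_eq_mul] at h1 h2
  have : ∀ i, c i • (x i : ℤ)
      = c i * ((x i % N : ℕ) : ℤ) + N * (c i * ((x i / N : ℕ) : ℤ)) := by
    intro i
    conv_lhs => rw [← Nat.mod_add_div (x i) N]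
    push_cast
    simp only [smul_eq_mul]
    ring
  simp_rw [this, Finset.sum_add_distrib, ← Finset.mul_sum, h1, h2]
  simp

lemma mem_H_iff {m k : ℕ} {a : Fin m → ℤ} :
    a ∈ H m k ↔ ∑ i, a i = 0 ∧ ∑ i, max (a i) 0 = k := by
  simp only [H, Set.mem_ofPred_eq, Finset.sum_filter]
  refine and_congr_right fun _ => Eq.congr_left (Finset.sum_congr rfl fun i _ => ?_)
  split_ifs <;> omega

lemma H_finite (m k : ℕ) : (H m k).Finite := by
  refine (Set.finite_Icc (fun _ => -(k : ℤ)) (fun _ => (k : ℤ))).subset fun a ha => ?_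
  rw [mem_H_iff] at ha
  have hneg : ∑ i, max (-a i) 0 = k := by
    rw [← ha.2, ← sub_eq_zero, ← Finset.sum_sub_distrib, ← neg_eq_zero, ← Finset.sum_neg_distrib,
      ← ha.1]
    exact Finset.sum_congr rfl fun i _ => by omega
  refine ⟨fun i => ?_, fun i => ?_⟩
  · have := Finset.single_le_sum (f := fun i => max (-a i) 0) (fun i _ => le_max_right _ _)
      (Finset.mem_univ i)
    simp only at this ⊢
    omega
  · have := Finset.single_le_sum (f := fun i => max (a i) 0) (fun i _ => le_max_right _ _)
      (Finset.mem_univ i)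
    simp only at this ⊢
    omega

lemma sum_max_zero_sum_le {ι κ : Type*} [Fintype ι] (s : Finset κ) (c : κ → ι → ℤ) :
    ∑ i, max ((∑ j ∈ s, c j) i) 0 ≤ ∑ j ∈ s, ∑ i, max (c j i) 0 := by
  rw [Finset.sum_comm]
  refine Finset.sum_le_sum fun i _ => ?_
  rw [Finset.sum_apply]
  exact max_le (Finset.sum_le_sum fun j _ => le_max_left _ _)
    (Finset.sum_nonneg fun j _ => le_max_right _ _)

lemma sum_single_sub_single {ι : Type*} [Fintype ι] [DecidableEq ι] (s t : ι) :
    ∑ i, (Pi.single s 1 - Pi.single t 1 : ι → ℤ) i = 0 := by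
  simp

lemma sum_max_single_sub_single_le {ι : Type*} [Fintype ι] [DecidableEq ι] (s t : ι) :
    ∑ i, max ((Pi.single s 1 - Pi.single t 1 : ι → ℤ) i) 0 ≤ 1 := by
  calc ∑ i, max ((Pi.single s 1 - Pi.single t 1 : ι → ℤ) i) 0
      ≤ ∑ i, (Pi.single s 1 : ι → ℤ) i := by
        refine Finset.sum_le_sum fun i _ => ?_
        simp only [Pi.sub_apply, Pi.single_apply]
        split_ifs <;> simp
    _ = 1 := by simp

lemma sum_single_sub_single_smul {ι G : Type*} [Fintype ι] [DecidableEq ι] [AddCommGroup G]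
    (f : ι → G) (s t : ι) :
    ∑ i, (Pi.single s 1 - Pi.single t 1 : ι → ℤ) i • f i = f s - f t := by
  simp [sub_smul, Finset.sum_sub_distrib, Pi.single_apply, ite_smul]

/-- Every element of `H m j` is a sum of `j` differences of standard basis vectors. -/
lemma exists_eq_sum_single_sub_single {m : ℕ} (j : ℕ) {c : Fin m → ℤ} (hc : c ∈ H m j) :
    ∃ s t : Fin j → Fin m, (∀ i, s i ≠ t i) ∧
      c = ∑ i, (Pi.single (s i) 1 - Pi.single (t i) 1) := by
  induction j generalizing c with
  | zero =>
    rw [mem_H_iff] at hc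
    have hnonpos : ∀ i, c i ≤ 0 := fun i => by
      have := Finset.single_le_sum (f := fun i => max (c i) 0) (fun i _ => le_max_right _ _)
        (Finset.mem_univ i)
      rw [hc.2] at this
      simp only [Nat.cast_zero] at this
      omega
    refine ⟨Fin.elim0, Fin.elim0, fun i => i.elim0, ?_⟩
    have := (Finset.sum_eq_zero_iff_of_nonpos fun i _ => hnonpos i).1 hc.1
    funext i
    simpa using this i (Finset.mem_univ i)
  | succ j ih =>
    rw [mem_H_iff] at hc
    obtain ⟨s, -, hs⟩ : ∃ s ∈ Finset.univ, 0 < max (c s) 0 := by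
      refine (Finset.sum_pos_iff_of_nonneg fun i _ => le_max_right _ _).1 ?_
      rw [hc.2]; positivity
    have hs : 0 < c s := by omega
    obtain ⟨t, ht⟩ : ∃ t, c t < 0 := by
      by_contra! h
      have := (Finset.sum_eq_zero_iff_of_nonneg fun i _ => h i).1 hc.1 s (Finset.mem_univ s)
      omega
    have hst : s ≠ t := by rintro rfl; omega
    have hmem : c - (Pi.single s 1 - Pi.single t 1) ∈ H m j := by
      rw [mem_H_iff]
      constructor
      · simp only [Pi.sub_apply, Finset.sum_sub_distrib, hc.1]; simp
      · have : ∀ i, max ((c - (Pi.single s 1 - Pi.single t 1) : Fin m → ℤ) i) 0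
            = max (c i) 0 - (Pi.single s 1 : Fin m → ℤ) i := by
          intro i
          simp only [Pi.sub_apply, Pi.single_apply]
          split_ifs with his hit hit
          · exact absurd (his.symm.trans hit) hst
          · subst his; omega
          · subst hit; omega
          · omega
        rw [Finset.sum_congr rfl fun i _ => this i, Finset.sum_sub_distrib, hc.2]
        simp
    obtain ⟨s', t', hne, heq⟩ := ih hmem
    refine ⟨Fin.cons s s', Fin.cons t t', Fin.cases hst hne, ?_⟩
    rw [Fin.sum_univ_succ]
    simp only [Fin.cons_zero, Fin.cons_succ, ← heq]
    abel

section

variable {m : ℕ} {G : Type*} [AddCommGroup G] {f : Fin m → G}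

/-- A `B_h` family with `h ≥ 2` is injective. -/
lemma IsBhFamily.injective {h : ℕ} (hf : IsBhFamily h f) (hh : 1 ≤ h) : Function.Injective f := by
  intro s t hst
  by_contra hne
  have h1 := hf (Pi.single s 1 - Pi.single t 1) (sum_single_sub_single s t)
    ((sum_max_single_sub_single_le s t).trans (by exact_mod_cast hh))
    (by rw [sum_single_sub_single_smul, hst, sub_self])
  have := congrFun h1 s
  simp [hne] at this

/-- Relations of a `B_h` family have trivial difference when their total weight is at most `h`. -/
lemma IsBhFamily.eq_of_sum_smul_eq {ι : Type*} [Fintype ι] {f : ι → G} {h : ℕ}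
    (hf : IsBhFamily h f) {c d : ι → ℤ}
    (hc : ∑ i, c i = 0) (hd : ∑ i, d i = 0)
    (hle : ∑ i, max (c i) 0 + ∑ i, max (d i) 0 ≤ h)
    (heq : ∑ i, c i • f i = ∑ i, d i • f i) : c = d := by
  refine sub_eq_zero.1 (hf (c - d) ?_ ?_ ?_)
  · simp [Finset.sum_sub_distrib, hc, hd]
  · have hneg : ∑ i, max (d i) 0 = ∑ i, max (-d i) 0 := by
      rw [← sub_eq_zero, ← Finset.sum_sub_distrib, ← hd]
      exact Finset.sum_congr rfl fun i _ => by omega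
    refine le_trans ?_ hle
    rw [hneg, ← Finset.sum_add_distrib]
    refine Finset.sum_le_sum fun i _ => ?_
    simp only [Pi.sub_apply]
    omega
  · simp only [Pi.sub_apply, sub_smul, Finset.sum_sub_distrib, heq, sub_self]

lemma IsBhFamily.hasDistinctDifferences {h : ℕ} (hf : IsBhFamily h f) (hh : 2 ≤ h) :
    HasDistinctDifferences (Set.range f) := by
  rintro _ ⟨a, rfl⟩ _ ⟨b, rfl⟩ _ ⟨a', rfl⟩ _ ⟨b', rfl⟩ hab hab' heq
  have h1 := hf.eq_of_sum_smul_eq (sum_single_sub_single a b) (sum_single_sub_single a' b')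
    (by have h2 := sum_max_single_sub_single_le a b
        have h3 := sum_max_single_sub_single_le a' b'
        have : (2 : ℤ) ≤ h := by exact_mod_cast hh
        linarith)
    (by rwa [sum_single_sub_single_smul, sum_single_sub_single_smul])
  have hne : a ≠ b := fun h => hab (congrArg f h)
  have ha := congrFun h1 a
  have hb := congrFun h1 b
  simp only [Pi.sub_apply, Pi.single_apply, if_neg hne, if_neg hne.symm, if_true] at ha hb
  refine ⟨congrArg f ?_, congrArg f ?_⟩
  · by_contra h; rw [if_neg h] at ha; split_ifs at ha <;> omega
  · by_contra h; rw [if_neg h] at hb; split_ifs at hb <;> omega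

/-- The `k`-hop coverage of a `B_{2k}` family is parametrised by the `H m j` for `1 ≤ j ≤ k`. -/
lemma IsBhFamily.khopSet_eq {k : ℕ} (hf : IsBhFamily (2 * k) f) :
    khopSet (Set.range f) k
      = (fun c : Fin m → ℤ => ∑ i, c i • f i) '' ⋃ j ∈ Finset.Icc 1 k, H m j := by
  ext x
  constructor
  · rintro ⟨hx, l, hl, a, b, hab, rfl⟩
    choose s hs using fun i => (hab i).1
    choose t ht using fun i => (hab i).2.1
    set c : Fin m → ℤ := ∑ i, (Pi.single (s i) 1 - Pi.single (t i) 1) with hcdef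
    have himg : ∑ i, c i • f i = ∑ i, (a i - b i) := by
      simp only [hcdef, Finset.sum_apply, Finset.sum_smul]
      rw [Finset.sum_comm]
      exact Finset.sum_congr rfl fun i _ => by rw [sum_single_sub_single_smul, hs, ht]
    have hc0 : ∑ i, c i = 0 := by
      simp only [hcdef, Finset.sum_apply]
      rw [Finset.sum_comm]
      exact Finset.sum_eq_zero fun i _ => sum_single_sub_single _ _
    have hle : ∑ i, max (c i) 0 ≤ l := by
      refine (sum_max_zero_sum_le _ _).trans
        ((Finset.sum_le_sum fun i _ => sum_max_single_sub_single_le _ _).trans ?_)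
      simp
    obtain ⟨j, hj⟩ := Int.eq_ofNat_of_zero_le
      (Finset.sum_nonneg fun i _ => le_max_right (c i) 0 : 0 ≤ ∑ i, max (c i) 0)
    have hcH : c ∈ H m j := mem_H_iff.2 ⟨hc0, hj⟩
    refine ⟨c, ?_, himg⟩
    simp only [Set.mem_iUnion, Finset.mem_Icc]
    refine ⟨j, ⟨Nat.one_le_iff_ne_zero.2 ?_, by omega⟩, hcH⟩
    rintro rfl
    obtain ⟨_, _, -, h0⟩ := exists_eq_sum_single_sub_single 0 hcH
    apply hx
    rw [← himg]
    simp [h0]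
  · rintro ⟨c, hc, rfl⟩
    simp only [Set.mem_iUnion, Finset.mem_Icc] at hc
    obtain ⟨j, ⟨hj1, hjk⟩, hc⟩ := hc
    have hcm := mem_H_iff.1 hc
    refine ⟨fun h0 => ?_, j, hjk, ?_⟩
    · have hc0 := hf c hcm.1 (by rw [hcm.2]; exact_mod_cast (by omega)) h0
      rw [hc0] at hcm
      simp at hcm
      omega
    · obtain ⟨s, t, hne, heq⟩ := exists_eq_sum_single_sub_single j hc
      refine ⟨fun i => f (s i), fun i => f (t i), fun i => ⟨⟨_, rfl⟩, ⟨_, rfl⟩, fun h => hne i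
        (hf.injective (by omega) h)⟩, ?_⟩
      simp only [heq, Finset.sum_apply, Finset.sum_smul]
      rw [Finset.sum_comm]
      exact Finset.sum_congr rfl fun i _ => sum_single_sub_single_smul _ _ _

lemma IsBhFamily.Ck_eq {k : ℕ} (hf : IsBhFamily (2 * k) f) :
    Ck (Set.range f) k = ∑ j ∈ Finset.Icc 1 k, (H m j).ncard := by
  rw [Ck, hf.khopSet_eq, Set.InjOn.ncard_image]
  · have hdisj : (↑(Finset.Icc 1 k) : Set ℕ).PairwiseDisjoint (H m) := by
      refine fun i _ j _ hij => Set.disjoint_left.2 fun c hc hd => hij ?_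
      exact_mod_cast (mem_H_iff.1 hc).2.symm.trans (mem_H_iff.1 hd).2
    have := (Finset.finite_toSet (Finset.Icc 1 k)).ncard_biUnion
      (fun j _ => H_finite m j) hdisj
    rwa [finsum_mem_coe_finset] at this
  · intro c hc d hd heq
    simp only [Set.mem_iUnion, Finset.mem_Icc] at hc hd
    obtain ⟨i, ⟨-, hi⟩, hc⟩ := hc
    obtain ⟨j, ⟨-, hj⟩, hd⟩ := hd
    rw [mem_H_iff] at hc hd
    refine hf.eq_of_sum_smul_eq hc.1 hd.1 ?_ heq
    rw [hc.2, hd.2]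
    exact_mod_cast (by omega)

end

open Finset in
/-- Disjoint pairs of `k`-subsets give elements of `H m k`. -/
lemma choose_mul_choose_le_ncard_H (m k : ℕ) :
    m.choose k * (m - k).choose k ≤ (H m k).ncard := by
  classical
  rw [Set.ncard_eq_toFinset_card _ (H_finite m k)]
  set S : Finset (Σ _ : Finset (Fin m), Finset (Fin m)) :=
    (powersetCard k univ).sigma fun A => powersetCard k Aᶜ with hS
  have hcard : S.card = m.choose k * (m - k).choose k := by
    rw [hS, card_sigma, sum_const_nat (m := (m - k).choose k)]
    · simp
    · intro A hA
      rw [card_powersetCard, card_compl, (mem_powersetCard.1 hA).2, Fintype.card_fin]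
  let φ : (Σ _ : Finset (Fin m), Finset (Fin m)) → Fin m → ℤ :=
    fun P i => (if i ∈ P.1 then 1 else 0) - (if i ∈ P.2 then 1 else 0)
  have hmem : ∀ P ∈ S, P.1.card = k ∧ P.2.card = k ∧ ∀ i, i ∈ P.2 → i ∉ P.1 := by
    intro P hP
    rw [hS, mem_sigma, mem_powersetCard, mem_powersetCard] at hP
    exact ⟨hP.1.2, hP.2.2, fun i hi => mem_compl.1 (hP.2.1 hi)⟩
  rw [← hcard]
  refine card_le_card_of_injOn φ (fun P hP => ?_) (fun P hP Q hQ h => ?_)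
  · obtain ⟨h1, h2, h3⟩ := hmem P hP
    simp only [Set.Finite.coe_toFinset, mem_H_iff]
    constructor
    · simp [φ, sum_sub_distrib, h1, h2]
    · have : ∀ i, max (φ P i) 0 = if i ∈ P.1 then 1 else 0 := by
        intro i
        have := h3 i
        simp only [φ]
        split_ifs <;> simp_all
      simp [this, h1]
  · have hP3 := (hmem P hP).2.2
    have hQ3 := (hmem Q hQ).2.2
    have key : ∀ i, (i ∈ P.1 ↔ i ∈ Q.1) ∧ (i ∈ P.2 ↔ i ∈ Q.2) := by
      intro i
      have hi := congrFun h i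
      have := hP3 i
      have := hQ3 i
      simp only [φ] at hi
      split_ifs at hi <;> simp_all
    obtain ⟨A, B⟩ := P
    obtain ⟨A', B'⟩ := Q
    obtain rfl : A = A' := Finset.ext fun i => (key i).1
    obtain rfl : B = B' := Finset.ext fun i => (key i).2
    rfl

lemma sub_pow_le_factorial_sq_mul_ncard_H (m k : ℕ) :
    (((m - 2 * k : ℕ) : ℝ) ^ k) ^ 2 ≤ (k.factorial : ℝ) ^ 2 * (H m k).ncard := by
  have h1 : (m - 2 * k) ^ k ≤ k.factorial * m.choose k := by
    rw [← Nat.descFactorial_eq_factorial_mul_choose]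
    exact (Nat.pow_le_pow_left (by omega) k).trans (Nat.pow_sub_le_descFactorial m k)
  have h2 : (m - 2 * k) ^ k ≤ k.factorial * (m - k).choose k := by
    rw [← Nat.descFactorial_eq_factorial_mul_choose]
    exact (Nat.pow_le_pow_left (by omega) k).trans (Nat.pow_sub_le_descFactorial (m - k) k)
  have h3 : ((m - 2 * k) ^ k) ^ 2 ≤ k.factorial ^ 2 * (H m k).ncard :=
    calc ((m - 2 * k) ^ k) ^ 2 ≤ (k.factorial * m.choose k) * (k.factorial * (m - k).choose k) := by
          rw [sq]; exact Nat.mul_le_mul h1 h2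
      _ = k.factorial ^ 2 * (m.choose k * (m - k).choose k) := by ring
      _ ≤ _ := Nat.mul_le_mul_left _ (choose_mul_choose_le_ncard_H m k)
  exact_mod_cast h3

/-- The embedding of `ℤ²` into the complex plane. -/
def latticeToComplex : ℤ × ℤ →+ ℂ where
  toFun p := ⟨p.1, p.2⟩
  map_zero' := by apply Complex.ext <;> simp
  map_add' p q := by apply Complex.ext <;> simp

lemma norm_latticeToComplex_sub (p q : ℤ × ℤ) :
    ‖latticeToComplex p - latticeToComplex q‖ = euclDistZ p q := by
  rw [← map_sub, euclDistZ, Complex.norm_eq_sqrt_sq_add_sq]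
  rfl

open MeasureTheory in
/-- A disc of radius `R` contains at most `π (R + 2)²` lattice points. -/
lemma ncard_le_of_norm_latticeToComplex_le {S : Set (ℤ × ℤ)} {R : ℝ} (hR : 0 ≤ R)
    (hS : ∀ x ∈ S, ‖latticeToComplex x‖ ≤ R) : (S.ncard : ℝ) ≤ Real.pi * (R + 2) ^ 2 := by
  rcases S.finite_or_infinite with hfin | hinf
  swap
  · rw [hinf.ncard]; simp only [Nat.cast_zero]; positivity
  rw [Set.ncard_eq_toFinset_card _ hfin]
  let Q : ℤ × ℤ → Set ℂ := fun x =>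
    Complex.measurableEquivRealProd ⁻¹' (Set.Ico (x.1 : ℝ) (x.1 + 1) ×ˢ Set.Ico (x.2 : ℝ) (x.2 + 1))
  have hmeas : ∀ x, MeasurableSet (Q x) := fun x =>
    Complex.measurableEquivRealProd.measurable (measurableSet_Ico.prod measurableSet_Ico)
  have hvol : ∀ x, volume (Q x) = 1 := by
    intro x
    rw [Complex.volume_preserving_equiv_real_prod.measure_preimage_equiv,
      Measure.volume_eq_prod, Measure.prod_prod]
    simp
  have hdisj : (hfin.toFinset : Set (ℤ × ℤ)).PairwiseDisjoint Q := by
    refine fun x _ y _ hxy => Set.disjoint_left.2 fun z hx hy => hxy ?_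
    simp only [Q, Set.mem_preimage, Complex.measurableEquivRealProd_apply, Set.mem_prod]
      at hx hy
    have hx1 := Int.floor_eq_iff.2 hx.1
    have hx2 := Int.floor_eq_iff.2 hx.2
    have hy1 := Int.floor_eq_iff.2 hy.1
    have hy2 := Int.floor_eq_iff.2 hy.2
    exact Prod.ext (hx1.symm.trans hy1) (hx2.symm.trans hy2)
  have hsub : (⋃ x ∈ hfin.toFinset, Q x) ⊆ Metric.ball 0 (R + 2) := by
    refine Set.iUnion₂_subset fun x hx z hz => ?_
    have hxR := hS x (hfin.mem_toFinset.1 hx)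
    simp only [Q, Set.mem_preimage, Complex.measurableEquivRealProd_apply, Set.mem_prod,
      Set.mem_Ico] at hz
    have h1 := Complex.norm_le_abs_re_add_abs_im (z - latticeToComplex x)
    have h2 : |(z - latticeToComplex x).re| < 1 := by
      rw [abs_lt]; simp only [Complex.sub_re, latticeToComplex, AddMonoidHom.coe_mk, ZeroHom.coe_mk]
      constructor <;> linarith
    have h3 : |(z - latticeToComplex x).im| < 1 := by
      rw [abs_lt]; simp only [Complex.sub_im, latticeToComplex, AddMonoidHom.coe_mk, ZeroHom.coe_mk]
      constructor <;> linarith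
    have h4 := norm_le_norm_add_norm_sub (latticeToComplex x) z
    rw [mem_ball_zero_iff]
    linarith [norm_sub_rev z (latticeToComplex x)]
  have hle := measure_mono (μ := volume) hsub
  rw [measure_biUnion_finset hdisj fun x _ => hmeas x] at hle
  simp only [hvol, Finset.sum_const, nsmul_eq_mul, mul_one, Complex.volume_ball] at hle
  have := ENNReal.toReal_mono (by finiteness) hle
  simp only [ENNReal.toReal_natCast, ENNReal.toReal_mul, ENNReal.toReal_pow] at this
  rw [ENNReal.toReal_ofReal (by linarith)] at this
  simpa [mul_comm] using this

lemma Ck_le_of_euclDistZ_le {D : Set (ℤ × ℤ)} {r : ℝ} (hr : 0 ≤ r)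
    (hD : ∀ v ∈ D, ∀ w ∈ D, euclDistZ v w ≤ r) (k : ℕ) :
    (Ck D k : ℝ) ≤ Real.pi * (k * r + 2) ^ 2 := by
  refine ncard_le_of_norm_latticeToComplex_le (by positivity) ?_
  rintro x ⟨-, l, hl, a, b, hab, rfl⟩
  rw [map_sum]
  calc ‖∑ i, latticeToComplex (a i - b i)‖ ≤ ∑ i, ‖latticeToComplex (a i - b i)‖ :=
        norm_sum_le _ _
    _ ≤ ∑ _i : Fin l, r := by
        refine Finset.sum_le_sum fun i _ => ?_
        rw [map_sub, norm_latticeToComplex_sub]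
        exact hD _ (hab i).1 _ (hab i).2.1
    _ = l * r := by simp
    _ ≤ k * r := by gcongr

lemma sub_pow_le_of_maximal_coverage {D : Set (ℤ × ℤ)} {k m : ℕ} {r : ℝ} (hk : 1 ≤ k) (hr : 0 ≤ r)
    (hD : ∀ v ∈ D, ∀ w ∈ D, euclDistZ v w ≤ r)
    (hC : Ck D k = ∑ i ∈ Finset.Icc 1 k, (H m i).ncard) :
    ((m - 2 * k : ℕ) : ℝ) ^ k ≤ Real.sqrt Real.pi * k.factorial * (k * r + 2) := by
  have h1 : (H m k).ncard ≤ Ck D k := by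
    rw [hC]
    exact Finset.single_le_sum (f := fun i => (H m i).ncard) (fun _ _ => Nat.zero_le _)
      (Finset.mem_Icc.2 ⟨hk, le_rfl⟩)
  have h2 : ((H m k).ncard : ℝ) ≤ Real.pi * (k * r + 2) ^ 2 :=
    (Nat.cast_le.2 h1).trans (Ck_le_of_euclDistZ_le hr hD k)
  refine (sq_le_sq₀ (by positivity) (by positivity)).1 ?_
  calc (((m - 2 * k : ℕ) : ℝ) ^ k) ^ 2 ≤ (k.factorial : ℝ) ^ 2 * (H m k).ncard :=
        sub_pow_le_factorial_sq_mul_ncard_H m k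
    _ ≤ (k.factorial : ℝ) ^ 2 * (Real.pi * (k * r + 2) ^ 2) := by gcongr
    _ = (Real.sqrt Real.pi * k.factorial * (k * r + 2)) ^ 2 := by
        rw [mul_pow, mul_pow, Real.sq_sqrt Real.pi_pos.le]; ring

/-- For `m ≥ 1` there is a `DD(m, r)` with maximal `k`-hop coverage and `r ≤ 2 (2m)^k`. -/
lemma exists_maximal_coverage {k m : ℕ} (hk : 1 ≤ k) (hm : m ≠ 0) :
    ∃ r : ℝ, r ≤ 2 * (2 * m) ^ k ∧ 0 < r ∧ ∃ D : Finset (ℤ × ℤ), D.card = m ∧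
      HasDistinctDifferences (↑D : Set (ℤ × ℤ)) ∧
      (∀ v ∈ D, ∀ w ∈ D, euclDistZ v w ≤ r) ∧
      Ck (↑D : Set (ℤ × ℤ)) k = ∑ i ∈ Finset.Icc 1 k, (H m i).ncard := by
  classical
  obtain ⟨p, hp, hmp, hp2⟩ := Nat.exists_prime_lt_and_le_two_mul m hm
  have := Fact.mk hp
  obtain ⟨x, hx, hB⟩ := exists_isBhFamily_natCast (ι := Fin m) (p := p) (h := 2 * k) (by omega)
    (by simpa using hmp.le)
  have hf := hB.prod_mod_div (N := p ^ k)
  set f : Fin m → ℤ × ℤ := fun i => (((x i % p ^ k : ℕ) : ℤ), ((x i / p ^ k : ℕ) : ℤ)) with hfdef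
  have hpk : 0 < p ^ k := pow_pos hp.pos k
  have hbox : ∀ i, (0 ≤ (f i).1 ∧ (f i).1 ≤ (p ^ k : ℕ)) ∧ 0 ≤ (f i).2 ∧ (f i).2 ≤ (p ^ k : ℕ) := by
    intro i
    refine ⟨⟨Int.natCast_nonneg _, ?_⟩, Int.natCast_nonneg _, ?_⟩
    · exact Int.ofNat_le.2 (Nat.mod_lt _ hpk).le
    · have : x i / p ^ k < p ^ k := Nat.div_lt_of_lt_mul (by
        rw [← sq, ← pow_mul, mul_comm k 2]; exact hx i)
      exact Int.ofNat_le.2 this.le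
  have hcoe : ((Finset.univ.image f : Finset (ℤ × ℤ)) : Set (ℤ × ℤ)) = Set.range f := by simp
  refine ⟨2 * (p : ℝ) ^ k, ?_, by exact_mod_cast Nat.mul_pos two_pos hpk, Finset.univ.image f,
    ?_, ?_, ?_, ?_⟩
  · have : (p : ℝ) ≤ 2 * m := by exact_mod_cast hp2
    gcongr
  · rw [Finset.card_image_of_injective _ (hf.injective (by omega))]; simp
  · rw [hcoe]; exact hf.hasDistinctDifferences (by omega)
  · intro v hv w hw
    obtain ⟨i, -, rfl⟩ := Finset.mem_image.1 hv
    obtain ⟨j, -, rfl⟩ := Finset.mem_image.1 hw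
    have h1 : |(((f i).1 - (f j).1 : ℤ) : ℝ)| ≤ (p : ℝ) ^ k := by
      have : |(f i).1 - (f j).1| ≤ (p ^ k : ℕ) := by
        rw [abs_le]; constructor <;> linarith [(hbox i).1, (hbox j).1]
      exact_mod_cast this
    have h2 : |(((f i).2 - (f j).2 : ℤ) : ℝ)| ≤ (p : ℝ) ^ k := by
      have : |(f i).2 - (f j).2| ≤ (p ^ k : ℕ) := by
        rw [abs_le]; constructor <;> linarith [(hbox i).2, (hbox j).2]
      exact_mod_cast this
    refine Real.sqrt_le_iff.2 ⟨by positivity, ?_⟩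
    nlinarith [sq_le_sq' (abs_le.1 h1).1 (abs_le.1 h1).2, sq_le_sq' (abs_le.1 h2).1 (abs_le.1 h2).2,
      sq_nonneg ((p : ℝ) ^ k)]
  · rw [hcoe]; exact hf.Ck_eq

lemma rkm_nonneg (k m : ℕ) : 0 ≤ rkm k m := Real.sInf_nonneg fun _ hr => hr.1.le

lemma rkm_le {k m : ℕ} (hk : 1 ≤ k) (hm : m ≠ 0) : rkm k m ≤ 2 * (2 * m) ^ k := by
  obtain ⟨r, hr, h⟩ := exists_maximal_coverage hk hm
  exact (csInf_le ⟨(0 : ℝ), fun _ hr => hr.1.le⟩ h).trans hr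

lemma le_rkm {k m : ℕ} (hk : 1 ≤ k) (hm : m ≠ 0) :
    ((m - 2 * k : ℕ) : ℝ) ^ k / (Real.sqrt Real.pi * k.factorial * k) - 2 / k ≤ rkm k m := by
  obtain ⟨r₀, -, h₀⟩ := exists_maximal_coverage hk hm
  refine le_csInf ⟨r₀, h₀⟩ ?_
  rintro r ⟨hr, D, -, -, hD, hC⟩
  have h := sub_pow_le_of_maximal_coverage hk hr.le hD hC
  have hk0 : (0 : ℝ) < k := by exact_mod_cast hk
  have hpi := Real.sqrt_pos.2 Real.pi_pos
  have hfac : (0 : ℝ) < k.factorial := by exact_mod_cast k.factorial_pos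
  rw [sub_le_iff_le_add, div_le_iff₀ (by positivity)]
  refine h.trans_eq ?_
  field_simp

theorem stmt13 (k : ℕ) (hk : 2 ≤ k) :
    1 / (Real.sqrt Real.pi * (Nat.factorial k : ℝ) * (k : ℝ)) ≤
      Filter.liminf (fun m : ℕ => rkm k m / (m : ℝ) ^ k) Filter.atTop ∧
    Filter.limsup (fun m : ℕ => rkm k m / (m : ℝ) ^ k) Filter.atTop ≤
      (1 / 2) * (16 / Real.pi) ^ k := by
  have hk1 : 1 ≤ k := by omega
  have hupper : ∀ᶠ m : ℕ in Filter.atTop,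
      rkm k m / (m : ℝ) ^ k ≤ (1 / 2) * (16 / Real.pi) ^ k := by
    filter_upwards [Filter.eventually_ne_atTop 0] with m hm
    have hm0 : (0 : ℝ) < m := by exact_mod_cast Nat.pos_of_ne_zero hm
    rw [div_le_iff₀ (by positivity)]
    have h4 : (4 : ℝ) ≤ 16 / Real.pi := by
      rw [le_div_iff₀ Real.pi_pos]; linarith [Real.pi_le_four]
    have h2 : (2 : ℝ) ^ 2 ≤ 2 ^ k := pow_le_pow_right₀ one_le_two hk
    have h5 : (4 : ℝ) ^ k ≤ (16 / Real.pi) ^ k := pow_le_pow_left₀ (by norm_num) h4 k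
    have h6 : (4 : ℝ) ^ k = 2 ^ k * 2 ^ k := by rw [← mul_pow]; norm_num
    have h7 : (2 : ℝ) * 2 ^ k ≤ 1 / 2 * (16 / Real.pi) ^ k := by nlinarith
    calc rkm k m ≤ 2 * (2 * m) ^ k := rkm_le hk1 hm
      _ = (2 * 2 ^ k) * (m : ℝ) ^ k := by rw [mul_pow]; ring
      _ ≤ _ := by gcongr
  have hnonneg : ∀ m : ℕ, 0 ≤ rkm k m / (m : ℝ) ^ k := fun m =>
    div_nonneg (rkm_nonneg k m) (by positivity)
  refine ⟨?_, Filter.limsup_le_of_le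
    (Filter.isCoboundedUnder_le_of_le Filter.atTop (x := 0) hnonneg) hupper⟩
  have hlim : Filter.Tendsto (fun m : ℕ =>
      (((m - 2 * k : ℕ) : ℝ) ^ k / (Real.sqrt Real.pi * k.factorial * k) - 2 / k) / (m : ℝ) ^ k)
      Filter.atTop (nhds (1 / (Real.sqrt Real.pi * k.factorial * k))) := by
    have h1 : Filter.Tendsto (fun m : ℕ => ((m - 2 * k : ℕ) : ℝ) / m) Filter.atTop (nhds 1) := by
      have : Filter.Tendsto (fun m : ℕ => 1 - ((2 * k : ℕ) : ℝ) / m) Filter.atTop (nhds (1 - 0)) :=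
        tendsto_const_nhds.sub (tendsto_const_div_atTop_nhds_zero_nat _)
      rw [sub_zero] at this
      refine this.congr' ?_
      filter_upwards [Filter.eventually_gt_atTop (2 * k)] with m hm
      have hm0 : (m : ℝ) ≠ 0 := by exact_mod_cast (by omega : m ≠ 0)
      rw [Nat.cast_sub hm.le]
      field_simp
    have h2 : Filter.Tendsto (fun m : ℕ => (2 / k : ℝ) / (m : ℝ) ^ k) Filter.atTop (nhds 0) :=
      tendsto_const_nhds.div_atTop
        ((Filter.tendsto_pow_atTop (by omega)).comp tendsto_natCast_atTop_atTop)
    have h3 := ((h1.pow k).div_const (Real.sqrt Real.pi * k.factorial * k)).sub h2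
    rw [one_pow, sub_zero] at h3
    refine h3.congr fun m => ?_
    rw [div_pow, sub_div, div_right_comm]
  rw [← hlim.liminf_eq]
  refine Filter.liminf_le_liminf ?_ hlim.isBoundedUnder_ge
    (Filter.isCoboundedUnder_ge_of_eventually_le Filter.atTop hupper)
  filter_upwards [Filter.eventually_ne_atTop 0] with m hm
  gcongr
  exact le_rkm hk1 hm
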